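/- arXiv:2507.07529 — 5 statements merged into one kernel-verified Lean document; each statement's English description precedes it below -/
import Mathlib

section
/- Let r be an odd prime and let X = SL₂(3^r) be the special linear group of degree 2 over the field with 3^r elements, and assume r is coprime to |X|. If τ is an automorphism of X of order 3r, then there exists an inner automorphism t of X with t ≠ id and t² = id such that the automorphism t∘τ has order 2r. -/
section CyclicGalois

open Finset

variable {K L : Type*} [Field K] [Field L] [Algebra K L] [FiniteDimensional K L] [IsGalois K L]
  {φ : L ≃ₐ[K] L}

lemma algebraMap_norm_eq_prod_pow (hφ : ∀ x, x ∈ Subgroup.zpowers φ) (x : L) :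
    algebraMap K L (Algebra.norm K x) = ∏ i ∈ range (orderOf φ), (φ ^ i) x := by
  classical
  rw [Algebra.norm_eq_prod_automorphisms, ← IsCyclic.image_range_orderOf hφ, prod_image]
  intro i hi j hj h
  exact pow_injOn_Iio_orderOf (by simpa using hi) (by simpa using hj) h

lemma algebraMap_trace_eq_sum_pow (hφ : ∀ x, x ∈ Subgroup.zpowers φ) (x : L) :
    algebraMap K L (Algebra.trace K L x) = ∑ i ∈ range (orderOf φ), (φ ^ i) x := by
  classical
  rw [trace_eq_sum_automorphisms, ← IsCyclic.image_range_orderOf hφ, sum_image]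
  intro i hi j hj h
  exact pow_injOn_Iio_orderOf (by simpa using hi) (by simpa using hj) h

lemma mem_range_algebraMap_of_fixed (hφ : ∀ x, x ∈ Subgroup.zpowers φ) {x : L} (hx : φ x = x) :
    x ∈ Set.range (algebraMap K L) := by
  rw [← IntermediateField.mem_bot, IsGalois.mem_bot_iff_fixed]
  intro f
  have h : Subgroup.zpowers φ ≤ MulAction.stabilizer (L ≃ₐ[K] L) x :=
    Subgroup.zpowers_le.2 hx
  exact h (hφ f)

/-- Additive Hilbert 90 for a cyclic Galois extension. -/
lemma exists_sub_of_trace_eq_zero (hφ : ∀ x, x ∈ Subgroup.zpowers φ) {y : L}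
    (hy : Algebra.trace K L y = 0) : ∃ z, φ z - z = y := by
  let D : L →ₗ[K] L := φ.toLinearMap - LinearMap.id
  have hle : LinearMap.range D ≤ LinearMap.ker (Algebra.trace K L) := by
    rintro _ ⟨z, rfl⟩
    simp [D, Algebra.trace_eq_of_algEquiv]
  have hker : Module.finrank K (LinearMap.ker D) ≤ 1 := by
    have : LinearMap.ker D ≤ K ∙ (1 : L) := fun x hx ↦ by
      obtain ⟨k, hk⟩ := mem_range_algebraMap_of_fixed hφ (x := x) (by
        simpa [D, sub_eq_zero] using hx)
      exact Submodule.mem_span_singleton.2 ⟨k, by rw [← hk, Algebra.algebraMap_eq_smul_one]⟩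
    exact (Submodule.finrank_mono this).trans (finrank_span_singleton one_ne_zero).le
  have h1 := LinearMap.finrank_range_add_finrank_ker D
  have h2 := LinearMap.finrank_range_add_finrank_ker (Algebra.trace K L)
  rw [LinearMap.range_eq_top.2 (Algebra.trace_surjective K L), finrank_top,
    Module.finrank_self] at h2
  have heq := Submodule.eq_of_le_of_finrank_le hle (by omega)
  have : y ∈ LinearMap.range D := heq ▸ hy
  simpa [D] using this

lemma exists_trace_eq_and_trace_mul_eq {s : L} (hs : s ∉ Set.range (algebraMap K L)) (c d : K) :
    ∃ y, Algebra.trace K L y = c ∧ Algebra.trace K L (s * y) = d := by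
  let T : L →ₗ[K] K × K :=
    (Algebra.trace K L).prod (Algebra.trace K L ∘ₗ LinearMap.mulLeft K s)
  have hT : Function.Surjective T := by
    rw [← LinearMap.dualMap_injective_iff, ← LinearMap.ker_eq_bot, LinearMap.ker_eq_bot']
    intro l hl
    have h0 : algebraMap K L (l (1, 0)) + algebraMap K L (l (0, 1)) * s = 0 := by
      refine (traceForm_nondegenerate K L).1 _ fun y ↦ ?_
      have h : l (Algebra.trace K L y, Algebra.trace K L (s * y)) = 0 :=
        LinearMap.congr_fun hl y
      have hsplit : ∀ a b : K, l (a, b) = a * l (1, 0) + b * l (0, 1) := fun a b ↦ by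
        rw [← smul_eq_mul, ← smul_eq_mul, ← map_smul, ← map_smul, ← map_add]
        simp
      rw [hsplit] at h
      rw [Algebra.traceForm_apply, add_mul, map_add, mul_assoc, ← Algebra.smul_def,
        ← Algebra.smul_def, map_smul, map_smul, smul_eq_mul, smul_eq_mul]
      linear_combination h
    have h1 : l (0, 1) = 0 := by
      by_contra hne
      refine hs ⟨-(l (1, 0)) / l (0, 1), ?_⟩
      have : algebraMap K L (l (0, 1)) ≠ 0 := by simpa using hne
      rw [map_div₀, map_neg, div_eq_iff this]
      linear_combination -h0
    have h2 : l (1, 0) = 0 := by simpa [h1] using h0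
    refine LinearMap.prod_ext ?_ ?_ <;> ext <;> simp [h1, h2]
  obtain ⟨y, hy⟩ := hT (c, d)
  exact ⟨y, congrArg Prod.fst hy, congrArg Prod.snd hy⟩

lemma exists_twisted_solution (hφ : ∀ x, x ∈ Subgroup.zpowers φ) (hodd : Odd (orderOf φ))
    (hne : φ ≠ 1) {c : L} (hc : Algebra.trace K L c ≠ 0) :
    ∃ a x y : L, a ≠ 0 ∧ x ≠ y ∧ a * φ a * (φ x - x + c) = -(φ y - y + c) := by
  obtain ⟨a, ha⟩ : ∃ a, φ a ≠ a := by
    by_contra! h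
    exact hne (AlgEquiv.ext h)
  have ha0 : a ≠ 0 := by
    rintro rfl
    simp at ha
  have hs : a * φ a ∉ Set.range (algebraMap K L) := by
    rintro ⟨k, hk⟩
    have h1 : φ (a * φ a) = a * φ a := by rw [← hk, AlgEquiv.commutes]
    have h2 : (φ ^ 2) a = a := by
      rw [map_mul, mul_comm] at h1
      exact mul_right_cancel₀ ((map_ne_zero φ).2 ha0) h1
    obtain ⟨m, hm⟩ := hodd
    have h3 : (φ ^ orderOf φ) a = a := by simp [pow_orderOf_eq_one]
    have h4 : ∀ m : ℕ, ((φ ^ 2) ^ m) a = a := fun m ↦ by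
      induction m with
      | zero => simp
      | succ m ih => rw [pow_succ, AlgEquiv.mul_apply, h2, ih]
    rw [hm, pow_succ', pow_mul, AlgEquiv.mul_apply, h4] at h3
    exact ha h3
  obtain ⟨u, hu, hsu⟩ := exists_trace_eq_and_trace_mul_eq hs (Algebra.trace K L c)
    (-Algebra.trace K L c)
  obtain ⟨x, hx⟩ := exists_sub_of_trace_eq_zero hφ (y := u - c) (by simp [hu])
  obtain ⟨y, hy⟩ := exists_sub_of_trace_eq_zero hφ (y := -(a * φ a * u) - c) (by
    rw [map_sub, map_neg, hsu]; ring)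
  refine ⟨a, x, y, ha0, ?_, by rw [hx, hy]; ring⟩
  rintro rfl
  have h1 : (a * φ a + 1) * u = 0 := by linear_combination hy - hx
  rcases mul_eq_zero.1 h1 with h | h
  · exact hs ⟨-1, by rw [map_neg, map_one]; linear_combination -h⟩
  · rw [h, map_zero] at hu
    exact hc hu.symm

end CyclicGalois

lemma isSquare_mul_map {F : Type*} [Field F] [Finite F] (hF : ringChar F ≠ 2) (f : F →+* F)
    (x : F) : IsSquare (x * f x) := by
  have := Fintype.ofFinite F
  by_cases hx : x = 0
  · simp [hx]
  rw [FiniteField.isSquare_iff hF (mul_ne_zero hx ((map_ne_zero f).2 hx)), mul_pow, ← map_pow]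
  rcases FiniteField.pow_dichotomy hF hx with h | h <;> simp [h]

namespace SL2

open Matrix

variable {p : ℕ} [Fact p.Prime] {F : Type*} [Field F] [Algebra (ZMod p) F]

local notation "SL₂" => Matrix.SpecialLinearGroup (Fin 2)
local notation "M₂" => Matrix (Fin 2) (Fin 2)

/-- The automorphism `τ` of `SL₂(F)` is the semilinear conjugation `A ↦ g f(A) g⁻¹`. -/
structure IsInducedBy (τ : MulAut (SL₂ F)) (g : M₂ F)
    (f : F ≃ₐ[ZMod p] F) : Prop where
  det_ne_zero : g.det ≠ 0
  map_mul : ∀ A : SL₂ F, (τ A : M₂ F) * g = g * (A : M₂ F).map f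

/-- Upper unitriangular matrices. -/
def upper (x : F) : SL₂ F := ⟨!![1, x; 0, 1], by simp⟩

/-- Lower unitriangular matrices. -/
def lower (x : F) : SL₂ F := ⟨!![1, 0; x, 1], by simp⟩

lemma coe_upper (x : F) : (upper x : M₂ F) = !![1, x; 0, 1] := rfl

lemma coe_lower (x : F) : (lower x : M₂ F) = !![1, 0; x, 1] := rfl

lemma upper_add (x y : F) : upper (x + y) = upper x * upper y := by
  ext i j
  fin_cases i <;> fin_cases j <;> simp [coe_upper, Matrix.mul_apply, add_comm]

lemma lower_add (x y : F) : lower (x + y) = lower x * lower y := by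
  ext i j
  fin_cases i <;> fin_cases j <;> simp [coe_lower, Matrix.mul_apply]

lemma upper_injective : Function.Injective (upper (F := F)) := fun x y h ↦ by
  simpa [coe_upper] using congrArg (fun A : SL₂ F ↦ (A : M₂ F) 0 1) h

lemma lower_injective : Function.Injective (lower (F := F)) := fun x y h ↦ by
  simpa [coe_lower] using congrArg (fun A : SL₂ F ↦ (A : M₂ F) 1 0) h

lemma upper_zero : upper (0 : F) = 1 := by
  ext i j
  fin_cases i <;> fin_cases j <;> simp [coe_upper]

lemma lower_zero : lower (0 : F) = 1 := by
  ext i j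
  fin_cases i <;> fin_cases j <;> simp [coe_lower]

lemma eq_top_of_upper_lower_mem (S : Subgroup (SL₂ F)) (hu : ∀ x, upper x ∈ S)
    (hl : ∀ x, lower x ∈ S) : S = ⊤ := by
  have key : ∀ A : SL₂ F, (A : M₂ F) 1 0 ≠ 0 → A ∈ S := by
    intro A hA
    have hdet := A.det_coe
    rw [det_fin_two] at hdet
    set a := (A : M₂ F) 0 0
    set b := (A : M₂ F) 0 1
    set c := (A : M₂ F) 1 0
    set d := (A : M₂ F) 1 1
    have : A = upper ((a - 1) / c) * lower c * upper ((d - 1) / c) := by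
      ext i j
      fin_cases i <;> fin_cases j <;>
        simp [coe_upper, coe_lower, Matrix.mul_apply] <;> grind
    rw [this]
    exact S.mul_mem (S.mul_mem (hu _) (hl _)) (hu _)
  refine eq_top_iff.2 fun A _ ↦ ?_
  by_cases hA : (A : M₂ F) 1 0 = 0
  · have hdet := A.det_coe
    rw [det_fin_two, hA] at hdet
    refine (S.mul_mem_cancel_left (hl 1)).1 (key _ ?_)
    simp [coe_lower, Matrix.mul_apply, hA]
    rintro h
    simp [h] at hdet
  · exact key A hA

/-- Conjugation of `SL₂(F)` by an invertible matrix. -/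
noncomputable def conjMatrix (P : M₂ F) (hP : P.det ≠ 0) : MulAut (SL₂ F) where
  toFun A := ⟨P * A * P⁻¹, by
    rw [det_mul, det_mul, A.det_coe, det_nonsing_inv, Ring.inverse_eq_inv']; field_simp⟩
  invFun A := ⟨P⁻¹ * A * P, by
    rw [det_mul, det_mul, A.det_coe, det_nonsing_inv, Ring.inverse_eq_inv']; field_simp⟩
  left_inv A := by
    ext1
    simp [Matrix.mul_assoc, hP, nonsing_inv_mul_cancel_left, nonsing_inv_mul]
  right_inv A := by
    ext1
    simp [Matrix.mul_assoc, hP, mul_nonsing_inv_cancel_left, mul_nonsing_inv]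
  map_mul' A B := by
    apply Subtype.ext
    change P * ((A : M₂ F) * B) * P⁻¹ = P * A * P⁻¹ * (P * B * P⁻¹)
    simp [Matrix.mul_assoc, hP, nonsing_inv_mul_cancel_left]

lemma map_one_algEquiv (A : M₂ F) : A.map (1 : F ≃ₐ[ZMod p] F) = A := by
  ext
  simp

lemma det_map_algEquiv (A : M₂ F) (f : F ≃ₐ[ZMod p] F) : (A.map f).det = f A.det := by
  simp [det_fin_two]

lemma isInducedBy_conjMatrix (P : M₂ F) (hP : P.det ≠ 0) :
    IsInducedBy (conjMatrix P hP) P (1 : F ≃ₐ[ZMod p] F) where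
  det_ne_zero := hP
  map_mul A := by
    change P * A * P⁻¹ * P = _
    simp [Matrix.mul_assoc, hP, nonsing_inv_mul, map_one_algEquiv]

lemma isInducedBy_conjMatrix_inv (P : M₂ F) (hP : P.det ≠ 0) :
    IsInducedBy (conjMatrix P hP)⁻¹ P⁻¹ (1 : F ≃ₐ[ZMod p] F) where
  det_ne_zero := by simpa [det_nonsing_inv, Ring.inverse_eq_inv'] using hP
  map_mul A := by
    change P⁻¹ * A * P * P⁻¹ = _
    simp [Matrix.mul_assoc, hP, mul_nonsing_inv, map_one_algEquiv]

namespace IsInducedBy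

variable {τ σ : MulAut (SL₂ F)} {g h : M₂ F} {f k : F ≃ₐ[ZMod p] F}

lemma one : IsInducedBy (1 : MulAut (SL₂ F)) 1 (1 : F ≃ₐ[ZMod p] F) where
  det_ne_zero := by simp
  map_mul A := by ext; simp

lemma mul (hτ : IsInducedBy τ g f) (hσ : IsInducedBy σ h k) :
    IsInducedBy (τ * σ) (g * h.map f) (f * k) where
  det_ne_zero := by
    simp [det_mul, det_map_algEquiv, hτ.det_ne_zero, hσ.det_ne_zero]
  map_mul A := by
    have h1 := hτ.map_mul (σ A)
    have h2 := congrArg (fun M : M₂ F ↦ M.map f) (hσ.map_mul A)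
    simp only [Matrix.map_mul] at h2
    rw [MulAut.mul_apply, ← Matrix.mul_assoc, h1, Matrix.mul_assoc, h2, ← Matrix.mul_assoc]
    rfl

lemma smul (hτ : IsInducedBy τ g f) {c : F} (hc : c ≠ 0) : IsInducedBy τ (c • g) f where
  det_ne_zero := by simp [hc, hτ.det_ne_zero]
  map_mul A := by simp [hτ.map_mul A]

lemma ext (hτ : IsInducedBy τ g f) (hσ : IsInducedBy σ g f) : τ = σ := by
  ext1 A
  apply Subtype.ext
  have h := (hτ.map_mul A).trans (hσ.map_mul A).symm
  exact mul_left_injective_of_inv _ _ (mul_nonsing_inv g hτ.det_ne_zero.isUnit) h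

lemma unique (hτ : IsInducedBy τ g f) (hτ' : IsInducedBy τ h k) :
    f = k ∧ ∃ c : F, c ≠ 0 ∧ g = c • h := by
  have hu : IsUnit h.det := hτ'.det_ne_zero.isUnit
  set m := h⁻¹ * g with hm
  have hcomm : ∀ A : SL₂ F, m * (A : M₂ F).map f = (A : M₂ F).map k * m := by
    intro A
    rw [hm, Matrix.mul_assoc, ← hτ.map_mul, ← Matrix.mul_assoc, ← Matrix.mul_assoc]
    congr 1
    have := hτ'.map_mul A
    calc h⁻¹ * (τ A : M₂ F) = h⁻¹ * ((τ A : M₂ F) * h) * h⁻¹ := by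
          simp [Matrix.mul_assoc, mul_nonsing_inv h hu]
      _ = _ := by rw [this, nonsing_inv_mul_cancel_left _ _ hu]
  have hmdet : m.det ≠ 0 := by
    simp [hm, det_mul, det_nonsing_inv, Ring.inverse_eq_inv', hτ.det_ne_zero, hτ'.det_ne_zero]
  have h1 := fun x i j ↦ congrFun₂ (hcomm (upper x)) i j
  have h2 := fun x i j ↦ congrFun₂ (hcomm (lower x)) i j
  have e1 := h1 1 0 0
  have e2 := h1 1 0 1
  have e3 := h2 1 0 0
  simp [coe_upper, coe_lower, Matrix.mul_apply] at e1 e2 e3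
  have hm00 : m 0 0 ≠ 0 := by
    intro h0
    rw [det_fin_two] at hmdet
    simp [e1, h0] at hmdet
  refine ⟨?_, m 0 0, hm00, ?_⟩
  · ext x
    have := h1 x 0 1
    simp [coe_upper, Matrix.mul_apply] at this
    rw [e3] at this
    have h11 : m 1 1 = m 0 0 := by grind
    rw [h11] at this
    have h01 : m 0 1 = 0 := e3
    refine mul_left_cancel₀ hm00 ?_
    grind
  · have : g = h * m := by rw [hm, mul_nonsing_inv_cancel_left _ _ hu]
    have hm' : m = m 0 0 • 1 := by
      ext i j
      fin_cases i <;> fin_cases j <;> simp <;> grind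
    rw [this, hm']
    simp

lemma conj (hτ : IsInducedBy τ g f) (P : M₂ F) (hP : P.det ≠ 0) :
    IsInducedBy ((conjMatrix P hP)⁻¹ * τ * conjMatrix P hP) (P⁻¹ * g * P.map f) f := by
  simpa [Matrix.mul_assoc, map_one_algEquiv] using ((isInducedBy_conjMatrix_inv P hP).mul hτ).mul
    (isInducedBy_conjMatrix P hP)

/-- The matrix inducing the `n`-th power of a semilinear conjugation. -/
def normMatrix (g : M₂ F) (f : F ≃ₐ[ZMod p] F) :
    ℕ → M₂ F
  | 0 => 1
  | n + 1 => g * (normMatrix g f n).map f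

lemma pow (hτ : IsInducedBy τ g f) (n : ℕ) : IsInducedBy (τ ^ n) (normMatrix g f n) (f ^ n) := by
  induction n with
  | zero => simpa using! one
  | succ n ih => rw [pow_succ', pow_succ']; exact hτ.mul ih

end IsInducedBy

/-- The antidiagonal element attached to `x ≠ 0`. -/
def weyl (x : F) (hx : x ≠ 0) : SL₂ F := ⟨!![0, x; -x⁻¹, 0], by simp [hx]⟩

lemma coe_weyl (x : F) (hx : x ≠ 0) : (weyl x hx : M₂ F) = !![0, x; -x⁻¹, 0] := rfl

lemma weyl_eq (x : F) (hx : x ≠ 0) : weyl x hx = upper x * lower (-x⁻¹) * upper x := by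
  ext i j
  fin_cases i <;> fin_cases j <;>
    simp [coe_weyl, coe_upper, coe_lower, Matrix.mul_apply, hx]

lemma weyl_mul_upper (x : F) (hx : x ≠ 0) :
    weyl x hx * upper 1 = lower (-(x⁻¹ * x⁻¹)) * weyl x hx := by
  ext i j
  fin_cases i <;> fin_cases j <;>
    simp [coe_weyl, coe_upper, coe_lower, Matrix.mul_apply, hx]

lemma weyl_mul (x y : F) (hx : x ≠ 0) (hy : y ≠ 0) :
    weyl (x * y) (mul_ne_zero hx hy) = weyl x hx * (weyl 1 one_ne_zero)⁻¹ * weyl y hy := by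
  apply Subtype.ext
  ext i j
  fin_cases i <;> fin_cases j <;>
    simp [coe_weyl, Matrix.mul_apply, adjugate_fin_two, mul_comm]

lemma weyl_injective {x y : F} (hx : x ≠ 0) (hy : y ≠ 0) (h : weyl x hx = weyl y hy) : x = y := by
  simpa [coe_weyl] using congrArg (fun A : SL₂ F ↦ (A : M₂ F) 0 1) h

lemma isInducedBy_one_of_normalized [Finite F] {τ : MulAut (SL₂ F)} {f g : F → F}
    (hu : ∀ x, τ (upper x) = upper (f x)) (hl : ∀ x, τ (lower x) = lower (g x)) (hf1 : f 1 = 1) :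
    ∃ φ : F ≃ₐ[ZMod p] F, IsInducedBy τ 1 φ := by
  have hadd : ∀ x y, f (x + y) = f x + f y := fun x y ↦ by
    apply upper_injective
    rw [← hu, upper_add, map_mul, hu, hu, upper_add]
  have hf0 : f 0 = 0 := by simpa using hadd 0 0
  have hg0 : g 0 = 0 := by
    apply lower_injective
    rw [← hl, lower_zero, map_one]
  have hinj : Function.Injective f := fun x y h ↦ by
    apply upper_injective
    apply τ.injective
    rw [hu, hu, h]
  have hne : ∀ x, x ≠ 0 → f x ≠ 0 := fun x hx h ↦ hx (hinj (h.trans hf0.symm))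
  have hfg : ∀ x, x ≠ 0 → g (-x⁻¹) = -(f x)⁻¹ := by
    intro x hx
    have h := congrArg τ (weyl_mul_upper x hx)
    rw [weyl_eq] at h
    simp only [map_mul, hu, hl, hf1] at h
    have h' := congrArg (fun A : SL₂ F ↦ (A : M₂ F) 0 1) h
    simp [coe_upper, coe_lower, Matrix.mul_apply] at h'
    have := hne x hx
    grind
  have hw : ∀ x (hx : x ≠ 0), τ (weyl x hx) = weyl (f x) (hne x hx) := by
    intro x hx
    rw [weyl_eq, weyl_eq, map_mul, map_mul, hu, hl, hfg x hx]
  have hmul : ∀ x y, f (x * y) = f x * f y := by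
    intro x y
    by_cases hx : x = 0
    · simp [hx, hf0]
    by_cases hy : y = 0
    · simp [hy, hf0]
    refine weyl_injective (hne _ (mul_ne_zero hx hy)) (mul_ne_zero (hne x hx) (hne y hy)) ?_
    rw [← hw _ (mul_ne_zero hx hy), weyl_mul x y hx hy, weyl_mul _ _ (hne x hx) (hne y hy)]
    simp only [map_mul, map_inv, hw, hf1]
  let φ₀ : F →+* F :=
    { toFun := f, map_one' := hf1, map_mul' := hmul, map_zero' := hf0, map_add' := hadd }
  let φ₁ : F →ₐ[ZMod p] F :=
    { φ₀ with commutes' := fun x ↦ RingHom.congr_fun (Subsingleton.elim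
        (φ₀.comp (algebraMap (ZMod p) F)) (algebraMap (ZMod p) F)) x }
  let φ : F ≃ₐ[ZMod p] F := AlgEquiv.ofBijective φ₁ ⟨hinj, Finite.surjective_of_injective hinj⟩
  have hφ : ∀ x, φ x = f x := fun _ ↦ rfl
  have hgf : ∀ x, g x = f x := by
    intro x
    by_cases hx : x = 0
    · rw [hx, hg0, hf0]
    have := hfg (-x⁻¹) (by simpa using hx)
    rw [← hφ, map_neg, map_inv₀, hφ] at this
    simpa using this
  refine ⟨φ, by simp, fun A ↦ ?_⟩
  have htop := eq_top_of_upper_lower_mem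
    (MonoidHom.eqLocus τ.toMonoidHom (SpecialLinearGroup.map (φ : F →+* F)))
    (fun x ↦ (hu x).trans ?_) (fun x ↦ (hl x).trans ?_)
  · have hA : A ∈ MonoidHom.eqLocus τ.toMonoidHom (SpecialLinearGroup.map (φ : F →+* F)) := by
      rw [htop]
      trivial
    have h : τ A = SpecialLinearGroup.map (φ : F →+* F) A := hA
    rw [h, Matrix.mul_one, Matrix.one_mul]
    rfl
  · ext i j
    change _ = φ ((upper x : M₂ F) i j)
    fin_cases i <;> fin_cases j <;> simp [coe_upper, hφ, hf0, hf1]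
  · ext i j
    change _ = φ ((lower x : M₂ F) i j)
    fin_cases i <;> fin_cases j <;> simp [coe_lower, hφ, hgf, hf0, hf1]

lemma eq_upper_of_mulVec {A : SL₂ F} (h : (A : M₂ F) *ᵥ ![1, 0] = ![1, 0]) :
    A = upper ((A : M₂ F) 0 1) := by
  have h0 := congrFun h 0
  have h1 := congrFun h 1
  have hdet := A.det_coe
  simp [mulVec, dotProduct] at h0 h1
  rw [det_fin_two, h0, h1] at hdet
  ext i j
  fin_cases i <;> fin_cases j <;> simp [coe_upper] <;> grind

lemma eq_lower_of_mulVec {A : SL₂ F} (h : (A : M₂ F) *ᵥ ![0, 1] = ![0, 1]) :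
    A = lower ((A : M₂ F) 1 0) := by
  have h0 := congrFun h 0
  have h1 := congrFun h 1
  have hdet := A.det_coe
  simp [mulVec, dotProduct] at h0 h1
  rw [det_fin_two, h0, h1] at hdet
  ext i j
  fin_cases i <;> fin_cases j <;> simp [coe_lower] <;> grind

/-- A homomorphism from the additive group of a finite field to `SL₂(F)` has a nonzero
fixed vector. -/
lemma exists_fixed_vector [Finite F] (ρ : Multiplicative F →* SL₂ F) :
    ∃ v : Fin 2 → F, v ≠ 0 ∧ ∀ x, (ρ x : M₂ F) *ᵥ v = v := by
  obtain ⟨p, _⟩ := CharP.exists F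
  have : Fact p.Prime := ⟨CharP.char_is_prime F p⟩
  let _ : MulAction (Multiplicative F) (Fin 2 → F) :=
    { smul := fun x v ↦ (ρ x : M₂ F) *ᵥ v
      one_smul := fun v ↦ by
        change (ρ 1 : M₂ F) *ᵥ v = v
        simp
      mul_smul := fun x y v ↦ by
        change (ρ (x * y) : M₂ F) *ᵥ v = (ρ x : M₂ F) *ᵥ ((ρ y : M₂ F) *ᵥ v)
        rw [mulVec_mulVec, map_mul]
        rfl }
  have hP : IsPGroup p (Multiplicative F) := fun x ↦ ⟨1, by
    rw [pow_one]
    change p • x.toAdd = (0 : F)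
    simp⟩
  have hdvd : p ∣ Nat.card (Fin 2 → F) := by
    have h1 : p ∣ Nat.card F := by
      have := addOrderOf_dvd_natCard (1 : F)
      rwa [CharP.eq F (CharP.addOrderOf_one F) ‹CharP F p›] at this
    simpa [Nat.card_fun] using dvd_pow h1 two_ne_zero
  obtain ⟨v, hv, h0⟩ := hP.exists_fixed_point_of_prime_dvd_card_of_fixed_point (Fin 2 → F) hdvd
    (a := 0) (fun x ↦ mulVec_zero _)
  exact ⟨v, h0.symm, hv⟩

lemma conjMatrix_inv_apply (P : M₂ F) (hP : P.det ≠ 0) (A : SL₂ F) :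
    (((conjMatrix P hP)⁻¹ A : SL₂ F) : M₂ F) = P⁻¹ * A * P := rfl

/-- Every automorphism of `SL₂` over a finite field is a semilinear conjugation. -/
theorem exists_isInducedBy [Finite F] (τ : MulAut (SL₂ F)) :
    ∃ (g : M₂ F) (φ : F ≃ₐ[ZMod p] F), IsInducedBy τ g φ := by
  obtain ⟨v, hv0, hv⟩ := exists_fixed_vector (F := F)
    { toFun := fun x ↦ τ (upper x.toAdd)
      map_one' := by simp [upper_zero]
      map_mul' := fun x y ↦ by simp [upper_add] }
  obtain ⟨w, hw0, hw⟩ := exists_fixed_vector (F := F)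
    { toFun := fun x ↦ τ (lower x.toAdd)
      map_one' := by simp [lower_zero]
      map_mul' := fun x y ↦ by simp [lower_add] }
  replace hv : ∀ x, (τ (upper x) : M₂ F) *ᵥ v = v := fun x ↦ hv (.ofAdd x)
  replace hw : ∀ x, (τ (lower x) : M₂ F) *ᵥ w = w := fun x ↦ hw (.ofAdd x)
  set P : M₂ F := !![v 0, w 0; v 1, w 1] with hPdef
  have hP : P.det ≠ 0 := by
    intro h
    obtain ⟨c, hc⟩ : ∃ c : F, v = c • w := by
      rw [hPdef, det_fin_two_of] at h
      by_cases h0 : w 0 = 0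
      · have h1 : w 1 ≠ 0 := fun h1 ↦ hw0 (by ext i; fin_cases i <;> simp [h0, h1])
        refine ⟨v 1 / w 1, ?_⟩
        ext i
        fin_cases i <;> simp <;> grind
      · refine ⟨v 0 / w 0, ?_⟩
        ext i
        fin_cases i <;> simp <;> grind
    let S : Subgroup (SL₂ F) :=
      { carrier := {A | (τ A : M₂ F) *ᵥ v = v}
        one_mem' := by
          change (τ 1 : M₂ F) *ᵥ v = v
          rw [map_one]
          exact one_mulVec v
        mul_mem' := fun {A B} hA hB ↦ by
          change (τ (A * B) : M₂ F) *ᵥ v = v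
          have h : (τ (A * B) : M₂ F) = (τ A : M₂ F) * (τ B : M₂ F) := by
            rw [map_mul]
            rfl
          rw [h, ← mulVec_mulVec, show (τ B : M₂ F) *ᵥ v = v from hB]
          exact hA
        inv_mem' := fun {A} hA ↦ by
          change (τ A⁻¹ : M₂ F) *ᵥ v = v
          have h : (τ A⁻¹ : M₂ F) * (τ A : M₂ F) = 1 := by
            rw [map_inv]
            exact congrArg Subtype.val (inv_mul_cancel (τ A))
          conv_lhs => rw [← show (τ A : M₂ F) *ᵥ v = v from hA]
          rw [mulVec_mulVec, h, one_mulVec] }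
    have hS := eq_top_of_upper_lower_mem S hv (fun x ↦ by
      change (τ (lower x) : M₂ F) *ᵥ v = v
      rw [hc, mulVec_smul, hw])
    have hall : ∀ A : SL₂ F, (A : M₂ F) *ᵥ v = v := fun A ↦ by
      have : τ.symm A ∈ S := hS ▸ Subgroup.mem_top _
      have h' : (τ (τ.symm A) : M₂ F) *ᵥ v = v := this
      rwa [MulEquiv.apply_symm_apply] at h'
    have e0 := congrFun (hall (upper 1)) 0
    have e1 := congrFun (hall (lower 1)) 1
    simp [coe_upper, coe_lower, mulVec, dotProduct] at e0 e1
    exact hv0 (by ext i; fin_cases i <;> simp [e0, e1])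
  have hPv : P *ᵥ ![1, 0] = v := by
    ext i
    fin_cases i <;> simp [hPdef, mulVec, dotProduct]
  have hPw : P *ᵥ ![0, 1] = w := by
    ext i
    fin_cases i <;> simp [hPdef, mulVec, dotProduct]
  set σ : MulAut (SL₂ F) := (conjMatrix P hP)⁻¹ * τ with hσ
  have hu : ∀ x, σ (upper x) = upper ((σ (upper x) : M₂ F) 0 1) := fun x ↦ by
    apply eq_upper_of_mulVec
    rw [hσ, MulAut.mul_apply, conjMatrix_inv_apply, ← mulVec_mulVec, hPv, ← mulVec_mulVec, hv,
      ← hPv, mulVec_mulVec, nonsing_inv_mul _ hP.isUnit, one_mulVec]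
  have hl : ∀ x, σ (lower x) = lower ((σ (lower x) : M₂ F) 1 0) := fun x ↦ by
    apply eq_lower_of_mulVec
    rw [hσ, MulAut.mul_apply, conjMatrix_inv_apply, ← mulVec_mulVec, hPw, ← mulVec_mulVec, hw,
      ← hPw, mulVec_mulVec, nonsing_inv_mul _ hP.isUnit, one_mulVec]
  set c := (σ (upper 1) : M₂ F) 0 1 with hc
  have hc0 : c ≠ 0 := by
    intro h
    have h1 := hu 1
    rw [← hc, h, upper_zero, ← map_one σ, ← upper_zero] at h1
    exact one_ne_zero (upper_injective (σ.injective h1))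
  have hD : (!![c, 0; 0, 1] : M₂ F).det ≠ 0 := by simpa using hc0
  obtain ⟨φ, hφ⟩ := isInducedBy_one_of_normalized (p := p)
    (τ := (conjMatrix !![c, 0; 0, 1] hD)⁻¹ * σ)
    (f := fun x ↦ c⁻¹ * (σ (upper x) : M₂ F) 0 1) (g := fun x ↦ c * (σ (lower x) : M₂ F) 1 0)
    (fun x ↦ by
      rw [MulAut.mul_apply, hu]
      apply Subtype.ext
      rw [conjMatrix_inv_apply, inv_def]
      ext i j
      fin_cases i <;> fin_cases j <;>
        simp [coe_upper, Matrix.mul_apply, adjugate_fin_two, hc0])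
    (fun x ↦ by
      rw [MulAut.mul_apply, hl]
      apply Subtype.ext
      rw [conjMatrix_inv_apply, inv_def]
      ext i j
      fin_cases i <;> fin_cases j <;>
        simp [coe_lower, Matrix.mul_apply, adjugate_fin_two, hc0, mul_comm])
    (by simp [← hc, hc0])
  have := (((isInducedBy_conjMatrix (p := p) P hP).mul
    (isInducedBy_conjMatrix !![c, 0; 0, 1] hD)).mul hφ)
  have e : conjMatrix P hP * conjMatrix !![c, 0; 0, 1] hD *
      ((conjMatrix !![c, 0; 0, 1] hD)⁻¹ * σ) = τ := by
    rw [hσ]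
    group
  rw [e] at this
  exact ⟨_, _, this⟩

section Powers

variable {τ : MulAut (SL₂ F)} {g : M₂ F} {f : F ≃ₐ[ZMod p] F}

lemma normMatrix_eq_pow (hg : g.map f = g) (n : ℕ) :
    IsInducedBy.normMatrix g f n = g ^ n := by
  induction n with
  | zero => rfl
  | succ n ih =>
    have h : (g ^ n).map f = (g.map f) ^ n := (f : F →+* F).mapMatrix.map_pow g n
    rw [IsInducedBy.normMatrix, ih, h, hg, pow_succ']

lemma normMatrix_apply_one_zero (h : g 1 0 = 0) (n : ℕ) :
    IsInducedBy.normMatrix g f n 1 0 = 0 := by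
  induction n with
  | zero => simp [IsInducedBy.normMatrix]
  | succ n ih => simp [IsInducedBy.normMatrix, Matrix.mul_apply, h, ih]

lemma normMatrix_apply_zero_zero (h : g 1 0 = 0) (h' : g 0 0 = 1) (n : ℕ) :
    IsInducedBy.normMatrix g f n 0 0 = 1 := by
  induction n with
  | zero => simp [IsInducedBy.normMatrix]
  | succ n ih =>
    simp [IsInducedBy.normMatrix, Matrix.mul_apply, h', ih, normMatrix_apply_one_zero h]

lemma normMatrix_apply_one_one (h : g 1 0 = 0) (n : ℕ) :
    IsInducedBy.normMatrix g f n 1 1 = ∏ i ∈ Finset.range n, (f ^ i) (g 1 1) := by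
  induction n with
  | zero => simp [IsInducedBy.normMatrix]
  | succ n ih =>
    have aux : ∀ i, f ((f ^ i) (g 1 1)) = (f ^ (i + 1)) (g 1 1) := fun i ↦ by
      rw [pow_succ', AlgEquiv.mul_apply]
    simp only [IsInducedBy.normMatrix, Matrix.mul_apply, Fin.sum_univ_two, h, zero_mul, zero_add,
      map_apply, ih, map_prod, aux, Finset.prod_range_succ', pow_zero, AlgEquiv.one_apply]
    rw [mul_comm]

lemma normMatrix_unipotent (b : F) (n : ℕ) : IsInducedBy.normMatrix !![1, b; 0, 1] f n =
    !![1, ∑ i ∈ Finset.range n, (f ^ i) b; 0, 1] := by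
  induction n with
  | zero =>
    ext i j
    fin_cases i <;> fin_cases j <;> simp [IsInducedBy.normMatrix]
  | succ n ih =>
    have aux : ∑ i ∈ Finset.range (n + 1), (f ^ i) b =
        f (∑ i ∈ Finset.range n, (f ^ i) b) + b := by
      simp only [Finset.sum_range_succ', map_sum, pow_succ', AlgEquiv.mul_apply, pow_zero,
        AlgEquiv.one_apply]
    rw [IsInducedBy.normMatrix, ih, aux]
    ext i j
    fin_cases i <;> fin_cases j <;> simp [Matrix.mul_apply]

lemma isInducedBy_conj (s : SL₂ F) :
    IsInducedBy (MulAut.conj s) (s : M₂ F) (1 : F ≃ₐ[ZMod p] F) where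
  det_ne_zero := by simp
  map_mul A := by
    have h : MulAut.conj s A * s = s * A := by simp
    rw [map_one_algEquiv]
    exact congrArg Subtype.val h

lemma IsInducedBy.eq_one {c : F} (hc : c ≠ 0)
    (h : IsInducedBy τ (c • (1 : M₂ F)) (1 : F ≃ₐ[ZMod p] F)) : τ = 1 :=
  h.ext (IsInducedBy.one.smul hc)

lemma pow_two_mul_card_eq_one [Finite F] (h : IsInducedBy τ g (1 : F ≃ₐ[ZMod p] F)) :
    τ ^ (2 * Nat.card (SL₂ F)) = 1 := by
  have h2 : IsInducedBy (τ * τ) (g * g) (1 : F ≃ₐ[ZMod p] F) := by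
    simpa [map_one_algEquiv] using h.mul h
  have hg := h.det_ne_zero
  let s : SL₂ F := ⟨g.det⁻¹ • (g * g), by
    rw [det_smul, det_mul, Fintype.card_fin]
    field_simp⟩
  have hs : τ ^ 2 = MulAut.conj s :=
    (pow_two τ).trans ((h2.smul (inv_ne_zero hg)).ext (isInducedBy_conj s))
  rw [pow_mul, hs, ← map_pow, pow_card_eq_one', map_one]

end Powers

section NormalForm

variable [Finite F] {τ : MulAut (SL₂ F)} {g : M₂ F} {φ : F ≃ₐ[ZMod p] F} {r : ℕ}

lemma IsInducedBy.exists_triangular (hτ : IsInducedBy τ g φ) (hr : φ ^ r = 1) (h1 : τ ^ r ≠ 1)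
    (hp : (τ ^ r) ^ p = 1) : ∃ P : M₂ F, P.det ≠ 0 ∧ (P⁻¹ * g * P.map φ) 1 0 = 0 := by
  have : CharP F p := charP_of_injective_algebraMap (algebraMap (ZMod p) F).injective p
  set N := normMatrix g φ r
  have hN : IsInducedBy (τ ^ r) N (1 : F ≃ₐ[ZMod p] F) := hr ▸ hτ.pow r
  have hNp := hN.pow p
  rw [hp, one_pow] at hNp
  obtain ⟨-, c, -, hc⟩ := hNp.unique one
  rw [normMatrix_eq_pow (map_one_algEquiv N)] at hc
  have hfrob : Function.Injective (frobenius F p) := frobenius_inj F p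
  obtain ⟨μ, hμ⟩ := Finite.surjective_of_injective hfrob c
  rw [frobenius_def] at hμ
  have hpow : (N - μ • (1 : M₂ F)) ^ p = 0 := by
    rw [sub_pow_char_of_commute (p := p) (h := (Commute.one_right N).smul_right μ), hc, smul_pow, hμ,
      one_pow, sub_self]
  have hdet : (N - μ • (1 : M₂ F)).det = 0 := by
    have := congrArg det hpow
    rw [det_pow, det_zero] at this
    exact pow_eq_zero_iff (Fact.out : p.Prime).ne_zero |>.1 this
  obtain ⟨v, hv0, hv⟩ := exists_mulVec_eq_zero_iff.2 hdet
  replace hv : N *ᵥ v = μ • v := by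
    rwa [sub_mulVec, smul_mulVec, one_mulVec, sub_eq_zero] at hv
  obtain ⟨-, ν, hν, hcomm⟩ := (hτ.mul hN).unique (pow_mul_comm' τ r ▸ hN.mul hτ)
  rw [map_one_algEquiv] at hcomm
  set w := g *ᵥ (φ ∘ v) with hw
  have hw0 : w ≠ 0 := by
    intro h
    have h2 : φ ∘ v = 0 := by
      by_contra hne
      exact hτ.det_ne_zero (exists_mulVec_eq_zero_iff.1 ⟨_, hne, h⟩)
    exact hv0 (funext fun i ↦ by simpa using congrFun h2 i)
  have hmap : N.map φ *ᵥ (φ ∘ v) = φ μ • (φ ∘ v) := by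
    have := (RingHom.map_mulVec (φ : F →+* F) N v)
    ext i
    have h := this i
    rw [hv] at h
    simpa using h.symm
  have hNw : N *ᵥ w = (ν⁻¹ * φ μ) • w := by
    have h2 : ν • (N *ᵥ w) = φ μ • w := by
      rw [hw, mulVec_mulVec, ← smul_mulVec, ← hcomm, ← mulVec_mulVec, hmap, mulVec_smul]
    rw [mul_smul, ← h2, smul_smul, inv_mul_cancel₀ hν, one_smul]
  have hpw : ∀ n : ℕ, (N ^ n) *ᵥ w = (ν⁻¹ * φ μ) ^ n • w := fun n ↦ by
    induction n with
    | zero => simp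
    | succ n ih => rw [pow_succ, ← mulVec_mulVec, hNw, mulVec_smul, ih, smul_smul, pow_succ']
  have hκ : ν⁻¹ * φ μ = μ := by
    apply hfrob
    have h2 := hpw p
    rw [hc, smul_mulVec, one_mulVec] at h2
    rw [frobenius_def, frobenius_def, hμ]
    exact (smul_left_injective F hw0 h2).symm
  rw [hκ] at hNw
  have hvw : v 0 * w 1 = v 1 * w 0 := by
    by_contra hne
    have hQ : (!![v 0, w 0; v 1, w 1] : M₂ F).det ≠ 0 := by
      rw [det_fin_two_of]
      intro h
      exact hne (by linear_combination h)
    have hNQ : N * !![v 0, w 0; v 1, w 1] = μ • !![v 0, w 0; v 1, w 1] := by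
      have a0 := congrFun hv 0
      have a1 := congrFun hv 1
      have b0 := congrFun hNw 0
      have b1 := congrFun hNw 1
      simp [mulVec, dotProduct] at a0 a1 b0 b1
      ext i j
      fin_cases i <;> fin_cases j <;> simp [Matrix.mul_apply, a0, a1, b0, b1]
    have hNμ : N = μ • (1 : M₂ F) := by
      rw [← Matrix.mul_one N, ← mul_nonsing_inv _ hQ.isUnit, ← Matrix.mul_assoc, hNQ, smul_mul]
    have hμ0 : μ ≠ 0 := by
      rintro rfl
      apply hN.det_ne_zero
      rw [hNμ, zero_smul, det_zero]
    exact h1 (eq_one hμ0 (hNμ ▸ hN))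
  obtain ⟨x, y, hxy⟩ : ∃ x y : F, v 0 * y - x * v 1 ≠ 0 := by
    by_cases h0 : v 0 = 0
    · refine ⟨1, 0, fun h ↦ hv0 ?_⟩
      have h1 : v 1 = 0 := by simpa using h
      ext i
      fin_cases i <;> simp [h0, h1]
    · exact ⟨0, 1, by simpa using h0⟩
  refine ⟨!![v 0, x; v 1, y], by rwa [det_fin_two_of], ?_⟩
  have hw0' : w 0 = g 0 0 * φ (v 0) + g 0 1 * φ (v 1) := by simp [hw]
  have hw1' : w 1 = g 1 0 * φ (v 0) + g 1 1 * φ (v 1) := by simp [hw]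
  rw [Matrix.mul_assoc, inv_def, smul_mul, Matrix.smul_apply, adjugate_fin_two_of]
  simp only [Matrix.mul_apply, Fin.sum_univ_two]
  simp [← hw0', ← hw1', ← hvw]

lemma IsInducedBy.exists_unipotent {F : Type} [Field F] [Algebra (ZMod p) F] [Finite F]
    {τ : MulAut (SL₂ F)} {g : M₂ F} {φ : F ≃ₐ[ZMod p] F} (hτ : IsInducedBy τ g φ)
    (hφ : ∀ x, x ∈ Subgroup.zpowers φ) (h1 : τ ^ orderOf φ ≠ 1)
    (hp : (τ ^ orderOf φ) ^ p = 1) : ∃ (π : MulAut (SL₂ F)) (b : F),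
      IsInducedBy (π⁻¹ * τ * π) !![1, b; 0, 1] φ ∧ Algebra.trace (ZMod p) F b ≠ 0 := by
  obtain ⟨P, hP, hP'⟩ := hτ.exists_triangular (pow_orderOf_eq_one φ) h1 hp
  have hσ := hτ.conj P hP
  set σ := (conjMatrix P hP)⁻¹ * τ * conjMatrix P hP with hσdef
  set B := P⁻¹ * g * P.map φ
  have hB00 : B 0 0 ≠ 0 := by
    intro h
    apply hσ.det_ne_zero
    rw [det_fin_two, h, hP']
    ring
  replace hσ := hσ.smul (inv_ne_zero hB00)
  set C := (B 0 0)⁻¹ • B with hC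
  have hC10 : C 1 0 = 0 := by simp [hC, hP']
  have hC00 : C 0 0 = 1 := by simp [hC, hB00]
  have hσp : (σ ^ orderOf φ) ^ p = 1 := by
    have hmul : σ = MulAut.conj (conjMatrix P hP)⁻¹ τ := by simp [hσdef]
    rw [hmul, ← map_pow, ← map_pow, hp, map_one]
  have hnorm : Algebra.norm (ZMod p) (C 1 1) = 1 := by
    have hM := hσ.pow (orderOf φ)
    have hM10 := normMatrix_apply_one_zero (f := φ) hC10 (orderOf φ)
    have hM00 := normMatrix_apply_zero_zero (f := φ) hC10 hC00 (orderOf φ)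
    have hM11 := normMatrix_apply_one_one (f := φ) hC10 (orderOf φ)
    rw [← algebraMap_norm_eq_prod_pow hφ] at hM11
    set M := normMatrix C φ (orderOf φ)
    rw [pow_orderOf_eq_one] at hM
    have hMp := hM.pow p
    rw [hσp, one_pow] at hMp
    obtain ⟨-, c, -, hc⟩ := hMp.unique one
    have e0 := normMatrix_apply_zero_zero (f := (1 : F ≃ₐ[ZMod p] F)) hM10 hM00 p
    have e1 := normMatrix_apply_one_one (f := (1 : F ≃ₐ[ZMod p] F)) hM10 p
    have hc1 : c = 1 := by simpa [hc] using e0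
    rw [hc, hc1, hM11] at e1
    simp only [one_smul, one_apply_eq, one_pow, AlgEquiv.one_apply, Finset.prod_const,
      Finset.card_range, ← map_pow] at e1
    rw [← map_one (algebraMap (ZMod p) F)] at e1
    have e2 := (algebraMap (ZMod p) F).injective e1
    rwa [map_pow, ZMod.pow_card, eq_comm] at e2
  obtain ⟨y, hy⟩ := groupCohomology.exists_div_of_norm_eq_one hφ hnorm
  have hD : (!![1, 0; 0, (y : F)] : M₂ F).det ≠ 0 := by simp
  have hρ := hσ.conj _ hD
  have hmat : (!![1, 0; 0, (y : F)] : M₂ F)⁻¹ * !![1, C 0 1; 0, C 1 1] * (!![1, 0; 0, (y : F)] : M₂ F).map φ =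
      !![1, C 0 1 * φ y; 0, 1] := by
    rw [inv_def, ← hy]
    have hy0 : φ y ≠ 0 := by simp
    ext i j
    fin_cases i <;> fin_cases j <;>
      simp [Matrix.mul_apply, adjugate_fin_two]
    field_simp
  have hCeta : C = !![1, C 0 1; 0, C 1 1] := by
    rw [← hC00, ← hC10]
    exact eta_fin_two C
  rw [hCeta, hmat] at hρ
  refine ⟨conjMatrix P hP * conjMatrix _ hD, C 0 1 * φ y, ?_, fun htr ↦ h1 ?_⟩
  · convert hρ using 1
    rw [hσdef]
    group
  · have h2 := hρ.pow (orderOf φ)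
    rw [normMatrix_unipotent, ← algebraMap_trace_eq_sum_pow hφ, htr, map_zero,
      pow_orderOf_eq_one, ← one_fin_two, ← one_smul F (1 : M₂ F)] at h2
    have h3 := h2.eq_one one_ne_zero
    have hmul : ∀ (α β : MulAut (SL₂ F)), α⁻¹ * β * α = MulAut.conj α⁻¹ β := fun α β ↦ by simp
    rwa [hmul, hσdef, hmul, ← map_pow, ← map_pow, EmbeddingLike.map_eq_one_iff,
      EmbeddingLike.map_eq_one_iff] at h3

end NormalForm

lemma orderOf_eq_of_isInducedBy_rotation {τ : MulAut (SL₂ F)} {φ : F ≃ₐ[ZMod p] F}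
    (h : IsInducedBy τ !![0, -1; 1, 0] φ) (hodd : Odd (orderOf φ)) :
    orderOf τ = 2 * orderOf φ := by
  have hJ : (!![0, -1; 1, 0] : M₂ F) ^ 2 = (-1 : F) • 1 := by
    rw [pow_two]
    ext i j
    fin_cases i <;> fin_cases j <;> simp [Matrix.mul_apply]
  have hJφ : (!![0, -1; 1, 0] : M₂ F).map φ = !![0, -1; 1, 0] := by
    ext i j
    fin_cases i <;> fin_cases j <;> simp
  apply Nat.dvd_antisymm
  · have h2 := h.pow (2 * orderOf φ)
    rw [normMatrix_eq_pow hJφ, pow_mul !![0, -1; 1, 0], hJ, smul_pow, one_pow, mul_comm 2, pow_mul φ,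
      pow_orderOf_eq_one, one_pow] at h2
    rw [mul_comm]
    exact orderOf_dvd_of_pow_eq_one (h2.eq_one (by simp))
  · have h2 := h.pow (orderOf τ)
    rw [pow_orderOf_eq_one, normMatrix_eq_pow hJφ] at h2
    obtain ⟨h3, c, -, hc⟩ := h2.unique IsInducedBy.one
    refine (Nat.coprime_two_left.2 hodd).mul_dvd_of_dvd_of_dvd ?_ (orderOf_dvd_of_pow_eq_one h3)
    rw [← even_iff_two_dvd]
    by_contra hn
    obtain ⟨k, hk⟩ := Nat.not_even_iff_odd.1 hn
    rw [hk, pow_succ, pow_mul, hJ, smul_pow, one_pow] at hc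
    have := congrFun₂ hc 1 0
    simp at this

lemma exists_conj_mul_orderOf_eq [Finite F] (hp2 : p ≠ 2) {σ : MulAut (SL₂ F)}
    {φ : F ≃ₐ[ZMod p] F} (hφ : ∀ x, x ∈ Subgroup.zpowers φ) (hodd : Odd (orderOf φ))
    (hφ1 : φ ≠ 1) {b : F} (hσ : IsInducedBy σ !![1, b; 0, 1] φ)
    (hb : Algebra.trace (ZMod p) F b ≠ 0) :
    ∃ s : SL₂ F, MulAut.conj s ≠ 1 ∧ MulAut.conj s ^ 2 = 1 ∧
      orderOf (MulAut.conj s * σ) = 2 * orderOf φ := by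
  have : CharP F p := charP_of_injective_algebraMap (algebraMap (ZMod p) F).injective p
  have hchar : ringChar F ≠ 2 := by rwa [ringChar.eq F p]
  obtain ⟨a, x, y, ha, hxy, heq⟩ := exists_twisted_solution hφ hodd hφ1 (c := -b) (by simpa)
  set H : M₂ F := !![a, a * x; 1, y] with hH
  have hHdet : H.det = a * (y - x) := by rw [hH, det_fin_two_of]; ring
  have hH0 : H.det ≠ 0 := by
    rw [hHdet]
    exact mul_ne_zero ha (sub_ne_zero.2 hxy.symm)
  have hφH0 : φ H.det ≠ 0 := by simpa using hH0
  obtain ⟨m, hm⟩ := isSquare_mul_map hchar (φ : F →+* F) H.det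
  replace hm : H.det * φ H.det = m * m := hm
  have hm0 : m ≠ 0 := by
    rintro rfl
    exact mul_ne_zero hH0 hφH0 (hm.trans (mul_zero 0))
  set T : M₂ F := H⁻¹ * !![0, -1; 1, 0] * H.map φ * !![1, -b; 0, 1] with hT
  have hTdet : T.det = H.det⁻¹ * φ H.det := by
    simp [hT, det_map_algEquiv, det_nonsing_inv]
  have hTtr : T 0 0 + T 1 1 = 0 := by
    rw [hT, inv_def, Ring.inverse_eq_inv', smul_mul, smul_mul, smul_mul]
    have hHφ : H.map φ = !![φ a, φ a * φ x; 1, φ y] := by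
      ext i j
      fin_cases i <;> fin_cases j <;> simp [hH]
    rw [hHφ, hH, adjugate_fin_two_of, mul_fin_two, mul_fin_two, mul_fin_two]
    simp only [Matrix.smul_apply, of_apply, cons_val_zero, cons_val_one, smul_eq_mul]
    rw [← mul_add]
    refine mul_eq_zero_of_right _ ?_
    linear_combination heq
  let s : SL₂ F := ⟨(m / φ H.det) • T, by
    rw [det_smul, hTdet, Fintype.card_fin]
    field_simp
    linear_combination -hm⟩
  have hs : (s : M₂ F) = (m / φ H.det) • T := rfl
  have hstr : (s : M₂ F) 0 0 + (s : M₂ F) 1 1 = 0 := by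
    simp [hs, ← mul_add, hTtr]
  have hsdet := s.det_coe
  rw [det_fin_two] at hsdet
  have hconj := isInducedBy_conj (p := p) s
  refine ⟨s, fun h ↦ ?_, ?_, ?_⟩
  · rw [h] at hconj
    obtain ⟨-, c, hc, hsc⟩ := hconj.unique IsInducedBy.one
    rw [hsc] at hstr
    simp [← two_mul, hc] at hstr
    exact Ring.two_ne_zero hchar hstr
  · have h2 := hconj.mul hconj
    rw [map_one_algEquiv, one_mul] at h2
    have hss : (s : M₂ F) * (s : M₂ F) = (-1 : F) • 1 := by
      ext i j
      fin_cases i <;> fin_cases j <;> simp [Matrix.mul_apply] <;> grind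
    rw [hss] at h2
    rw [pow_two]
    exact h2.eq_one (by simp)
  · have h2 := (hconj.mul hσ).smul (c := (m / φ H.det)⁻¹) (by simp [hm0, hH0])
    have hmat : (m / φ H.det)⁻¹ • ((s : M₂ F) * (!![1, b; 0, 1] : M₂ F).map
        (1 : F ≃ₐ[ZMod p] F)) = H⁻¹ * !![0, -1; 1, 0] * H.map φ := by
      have hinv : (!![1, -b; 0, 1] : M₂ F) * !![1, b; 0, 1] = 1 := by
        ext i j
        fin_cases i <;> fin_cases j <;> simp [Matrix.mul_apply]
      rw [map_one_algEquiv, hs, smul_mul, smul_smul, inv_mul_cancel₀ (by simp [hm0, hH0]),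
        one_smul, hT, Matrix.mul_assoc _ _ (!![1, b; 0, 1] : M₂ F), hinv, Matrix.mul_one]
    rw [hmat, one_mul] at h2
    have hHinv : H⁻¹.det ≠ 0 := by simpa [det_nonsing_inv] using hH0
    have h3 := h2.conj H⁻¹ hHinv
    have hφH : H.map φ * H⁻¹.map φ = 1 := by
      rw [← Matrix.map_mul, mul_nonsing_inv _ hH0.isUnit]
      simp
    rw [nonsing_inv_nonsing_inv _ hH0.isUnit, Matrix.mul_assoc H⁻¹,
      mul_nonsing_inv_cancel_left _ _ hH0.isUnit, Matrix.mul_assoc, hφH, Matrix.mul_one] at h3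
    rw [← orderOf_eq_of_isInducedBy_rotation h3 hodd]
    have h4 := (MulAut.conj (conjMatrix H⁻¹ hHinv)⁻¹).orderOf_eq (MulAut.conj s * σ)
    rw [← h4]
    simp

end SL2

/-- **Lemma 3.8.**  Let `X = SL₂(3^r)` with `r` an odd prime coprime to `|X|`.  If
`τ ∈ Aut(X)` has order `3r`, then there is a nontrivial inner automorphism `t` of `X`
with `t² = 1` such that `t ∘ τ` has order `2r`. -/
theorem stmt15 (r : ℕ) (hr : r.Prime) (hrodd : Odd r)
    (hcop : Nat.Coprime r (Nat.card (Matrix.SpecialLinearGroup (Fin 2) (GaloisField 3 r))))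
    (τ : MulAut (Matrix.SpecialLinearGroup (Fin 2) (GaloisField 3 r)))
    (hτ : orderOf τ = 3 * r) :
    ∃ t : MulAut (Matrix.SpecialLinearGroup (Fin 2) (GaloisField 3 r)),
      (∃ g, t = MulAut.conj g) ∧ t ≠ 1 ∧ t ^ 2 = 1 ∧ orderOf (t * τ) = 2 * r := by
  have : Fact (Nat.Prime r) := ⟨hr⟩
  have h3 : Fact (Nat.Prime 3) := ⟨Nat.prime_three⟩
  obtain ⟨g, φ, hg⟩ := SL2.exists_isInducedBy (p := 3) τ
  have hcard : Nat.card (GaloisField 3 r ≃ₐ[ZMod 3] GaloisField 3 r) = r :=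
    (IsGalois.card_aut_eq_finrank _ _).trans (GaloisField.finrank 3 hr.ne_zero)
  have hφ1 : φ ≠ 1 := by
    rintro rfl
    have hdvd : 3 * r ∣ 2 * _ := hτ ▸ orderOf_dvd_of_pow_eq_one (SL2.pow_two_mul_card_eq_one hg)
    have h2 := hcop.dvd_of_dvd_mul_right ((Dvd.intro_left 3 rfl).trans hdvd)
    obtain h2 | h2 := (Nat.dvd_prime Nat.prime_two).1 h2
    · exact hr.one_lt.ne' h2
    · exact absurd (h2 ▸ hrodd) (by decide)
  have hgen : ∀ x, x ∈ Subgroup.zpowers φ := fun x ↦ mem_zpowers_of_prime_card hcard hφ1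
  have hφ : orderOf φ = r := (orderOf_eq_card_of_forall_mem_zpowers hgen).trans hcard
  have hτr : τ ^ orderOf φ ≠ 1 := by
    intro h
    have h2 := Nat.le_of_dvd (orderOf_pos φ) (orderOf_dvd_of_pow_eq_one h)
    rw [hτ, hφ] at h2
    have := hr.pos
    omega
  have hτ3 : (τ ^ orderOf φ) ^ 3 = 1 := by
    rw [← pow_mul, hφ, mul_comm, ← hτ, pow_orderOf_eq_one]
  obtain ⟨π, b, hσ, hb⟩ := hg.exists_unipotent hgen hτr hτ3
  obtain ⟨s, hs1, hs2, hs⟩ :=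
    SL2.exists_conj_mul_orderOf_eq (by norm_num) hgen (hφ.symm ▸ hrodd) hφ1 hσ hb
  have ht : MulAut.conj (π s) = MulAut.conj π (MulAut.conj s) := by
    ext1 x
    simp
  refine ⟨MulAut.conj (π s), ⟨_, rfl⟩, ?_, ?_, ?_⟩
  · rwa [ht, Ne, EmbeddingLike.map_eq_one_iff]
  · rw [ht, ← map_pow, hs2, map_one]
  · have hconj : MulAut.conj (π s) * τ =
        MulAut.conj π (MulAut.conj s * (π⁻¹ * τ * π)) := by
      rw [ht]
      simp only [MulAut.conj_apply]
      group
    rw [hconj, MulEquiv.orderOf_eq, hs, hφ]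
end

section
/- Let n ≥ 5 and let x be a permutation of a set of size n whose set of fixed points has cardinality t with t < n − 3. Then there exists an even permutation y such that the product x·(y⁻¹xy) has at least t + 1 and fewer than n fixed points (in particular x·x^y is not the identity). -/
open Equiv Equiv.Perm

lemma card_fixed_eq_sub_support {n : ℕ} (x : Perm (Fin n)) :
    Nat.card {i : Fin n | x i = i} = n - x.support.card := by
  have h : {i : Fin n | x i = i} = ((x.supportᶜ : Finset (Fin n)) : Set (Fin n)) := by
    ext i
    simp
  rw [h, Nat.card_coe_set_eq, Set.ncard_coe_finset, Finset.card_compl, Fintype.card_fin]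

/-- If `w` conjugates `x` to its inverse and `c` does not commute with `x`, then
`y = w * c` makes `x * (y⁻¹ * x * y)` a nontrivial permutation, supported where `c` or
`x * c * x⁻¹` is. -/
lemma exists_even_conj_of_inverter {n t : ℕ} {x w c : Perm (Fin n)}
    (hw : w⁻¹ * x * w = x⁻¹) (hsign : sign (w * c) = 1) (hc : c * x ≠ x * c)
    (s : Finset (Fin n)) (hs : ∀ i, c i ≠ i → i ∈ s ∧ x i ∈ s) (hcard : t + 1 + s.card ≤ n) :
    ∃ y : Perm (Fin n), y ∈ alternatingGroup (Fin n) ∧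
      t + 1 ≤ Nat.card {i : Fin n | (x * (y⁻¹ * x * y)) i = i} ∧
      Nat.card {i : Fin n | (x * (y⁻¹ * x * y)) i = i} < n := by
  have hy : (w * c)⁻¹ * x * (w * c) = c⁻¹ * x⁻¹ * c := by
    rw [← hw]
    group
  refine ⟨w * c, mem_alternatingGroup.mpr hsign, ?_⟩
  rw [hy, card_fixed_eq_sub_support]
  have hsub : (x * (c⁻¹ * x⁻¹ * c)).support ⊆ s := by
    intro i hi
    contrapose! hi
    have h₁ : c i = i := by
      by_contra h
      exact hi (hs i h).1
    have h₂ : c (x⁻¹ i) = x⁻¹ i := by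
      by_contra h
      exact hi (by simpa using (hs _ h).2)
    have h₃ : c⁻¹ (x⁻¹ i) = x⁻¹ i := by rw [inv_eq_iff_eq, h₂]
    simp only [notMem_support, Perm.mul_apply, h₁, h₃]
    simp
  have hle := Finset.card_le_card hsub
  have hpos : 0 < (x * (c⁻¹ * x⁻¹ * c)).support.card := by
    rw [Finset.card_pos, Finset.nonempty_iff_ne_empty, Ne, support_eq_empty_iff]
    intro h
    apply hc
    calc c * x = c * (1 * x) := by group
      _ = c * ((x * (c⁻¹ * x⁻¹ * c))⁻¹ * x) := by rw [h, inv_one]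
      _ = x * c := by group
  omega

lemma exists_conj_eq_inv {n : ℕ} (x : Perm (Fin n)) : ∃ w : Perm (Fin n), w⁻¹ * x * w = x⁻¹ := by
  obtain ⟨w, hw⟩ := isConj_iff.mp (isConj_iff_cycleType_eq.mpr (cycleType_inv x))
  refine ⟨w, ?_⟩
  calc w⁻¹ * x * w = w⁻¹ * (w * x⁻¹ * w⁻¹) * w := by rw [hw]
    _ = x⁻¹ := by group

lemma swap_moves {α : Type*} [DecidableEq α] {a b i : α} (h : swap a b i ≠ i) :
    i = a ∨ i = b := by
  by_contra! hne
  exact h (swap_apply_of_ne_of_ne hne.1 hne.2)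

lemma swap_mul_ne_mul_swap {α : Type*} [DecidableEq α] {x : Perm α} {a b : α} (hab : a ≠ b)
    (ha : x a ≠ a) (h : x a = b → x b ≠ a) : swap a b * x ≠ x * swap a b := by
  intro heq
  have h₁ := congrArg (· a) heq
  simp only [Perm.mul_apply, swap_apply_left] at h₁
  by_cases hb : x a = b
  · rw [hb, swap_apply_right] at h₁
    exact h hb h₁.symm
  · rw [swap_apply_of_ne_of_ne ha hb] at h₁
    exact hab (x.injective h₁)

/-- There is a transposition not commuting with `x` whose support, together with its image
under `x`, has fewer points than the support of `x`. -/
lemma exists_noncomm_swap {n : ℕ} (hn : 5 ≤ n) {x : Perm (Fin n)} (hx : 4 ≤ x.support.card) :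
    ∃ c : Perm (Fin n), sign c = -1 ∧ c * x ≠ x * c ∧ ∃ s : Finset (Fin n),
      (∀ i, c i ≠ i → i ∈ s ∧ x i ∈ s) ∧ s.card < x.support.card := by
  by_cases h2 : ∃ a, x (x a) ≠ a
  · obtain ⟨a, ha⟩ := h2
    have ha' : x a ≠ a := fun h => ha (by rw [h, h])
    refine ⟨swap a (x a), sign_swap ha'.symm, swap_mul_ne_mul_swap ha'.symm ha' fun _ => ha,
      {a, x a, x (x a)}, ?_, lt_of_le_of_lt Finset.card_le_three (by omega)⟩
    intro i hi
    rcases swap_moves hi with rfl | rfl <;> simp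
  push Not at h2
  obtain ⟨a, ha⟩ := Finset.card_pos.mp (show 0 < x.support.card by omega)
  rw [mem_support] at ha
  by_cases hf : ∃ f, x f = f
  · obtain ⟨f, hf⟩ := hf
    have haf : a ≠ f := by
      rintro rfl
      exact ha hf
    refine ⟨swap a f, sign_swap haf, swap_mul_ne_mul_swap haf ha fun _ h => haf (h ▸ hf),
      {a, f, x a}, ?_, lt_of_le_of_lt Finset.card_le_three (by omega)⟩
    intro i hi
    rcases swap_moves hi with rfl | rfl <;> simp [hf]
  · push Not at hf
    have hu : x.support = Finset.univ := by
      ext i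
      simp [hf i]
    have hcard : x.support.card = n := by simp [hu]
    obtain ⟨b, hb⟩ : ∃ b, b ∉ ({a, x a} : Finset (Fin n)) := by
      by_contra! h
      have h₁ := Finset.card_le_card (fun i _ => h i : Finset.univ ⊆ ({a, x a} : Finset (Fin n)))
      have h₂ := Finset.card_le_two (a := a) (b := x a)
      simp only [Finset.card_univ, Fintype.card_fin] at h₁
      omega
    simp only [Finset.mem_insert, Finset.mem_singleton, not_or] at hb
    refine ⟨swap a b, sign_swap (Ne.symm hb.1),
      swap_mul_ne_mul_swap (Ne.symm hb.1) ha fun h => absurd h.symm hb.2,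
      {a, b, x a, x b}, ?_, lt_of_le_of_lt Finset.card_le_four (by omega)⟩
    intro i hi
    rcases swap_moves hi with rfl | rfl <;> simp

/-- If `x` has a cycle of length at least `5`, the same is achieved by an even permutation. -/
lemma exists_noncomm_threeCycle {n : ℕ} {x : Perm (Fin n)} {k : ℕ} (hk : k ∈ x.cycleType)
    (hk5 : 5 ≤ k) :
    ∃ c : Perm (Fin n), sign c = 1 ∧ c * x ≠ x * c ∧ ∃ s : Finset (Fin n),
      (∀ i, c i ≠ i → i ∈ s ∧ x i ∈ s) ∧ s.card < x.support.card := by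
  have hsupp : k ≤ x.support.card := sum_cycleType x ▸ Multiset.le_sum_of_mem hk
  rw [cycleType_def, Multiset.mem_map] at hk
  obtain ⟨g, hg, rfl⟩ := hk
  obtain ⟨a, ha⟩ := Finset.card_pos.mp (show 0 < g.support.card by simp at hk5; omega)
  have hga : g = x.cycleOf a := cycle_is_cycleOf ha hg
  have hpow : ∀ m, 0 < m → m < 5 → (x ^ m) a ≠ a := by
    intro m hm hm5 h
    have hcyc := isCycleOn_support_cycleOf x a
    rw [← hga] at hcyc
    have := Nat.le_of_dvd hm ((hcyc.pow_apply_eq ha).mp h)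
    simp at hk5
    omega
  have h1 : x a ≠ a := hpow 1 (by simp) (by simp)
  have h2 : x (x a) ≠ a := hpow 2 (by simp) (by simp)
  have h3 : x (x (x a)) ≠ a := hpow 3 (by simp) (by simp)
  have h12 : x (x a) ≠ x a := fun h => h1 (x.injective h)
  refine ⟨swap a (x a) * swap (x a) (x (x a)), ?_, ?_, {a, x a, x (x a), x (x (x a))}, ?_,
    lt_of_le_of_lt Finset.card_le_four (by simp at hk5 hsupp; omega)⟩
  · rw [Perm.sign_mul, sign_swap h1.symm, sign_swap h12.symm]
    simp
  · intro heq
    have h := congrArg (· (x a)) heq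
    simp only [Perm.mul_apply, swap_apply_left, swap_apply_right,
      swap_apply_of_ne_of_ne h2 h12] at h
    exact h3 h.symm
  · intro i hi
    have hi' : i = a ∨ i = x a ∨ i = x (x a) := by
      by_contra! hne
      apply hi
      rw [Perm.mul_apply, swap_apply_of_ne_of_ne hne.2.1 hne.2.2,
        swap_apply_of_ne_of_ne hne.1 hne.2.1]
    rcases hi' with rfl | rfl | rfl <;> simp

/-- If all permutations commuting with `x` are even, then `x` has a cycle of length at least `5`,
unless it moves at most `3` points. -/
lemma exists_five_le_mem_cycleType {n : ℕ} {x : Perm (Fin n)} (hx : 4 ≤ x.support.card)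
    (h : Subgroup.centralizer {x} ≤ alternatingGroup (Fin n)) : ∃ k ∈ x.cycleType, 5 ≤ k := by
  obtain ⟨hodd, -, hcount⟩ := centralizer_le_alternating_iff.mp h
  by_contra! hlt
  have hthree : ∀ k ∈ x.cycleType, k = 3 := by
    intro k hk
    obtain ⟨m, hm⟩ := hodd k hk
    have := two_le_of_mem_cycleType hk
    have := hlt k hk
    omega
  have hsum := sum_cycleType x
  rw [Multiset.eq_replicate_card.mpr hthree, Multiset.sum_replicate, smul_eq_mul] at hsum
  have := hcount 3
  rw [Multiset.eq_replicate_card.mpr hthree, Multiset.count_replicate_self] at this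
  omega

/-- **Lemma 4.1.**  Let `n ≥ 5` and `x ∈ Sym(n)` with `|Fix(x)| = t < n - 3`.  Then there
is `y ∈ Alt(n)` with `n > |Fix(x x^y)| ≥ t + 1`. -/
theorem stmt16 (n : ℕ) (hn : 5 ≤ n) (x : Equiv.Perm (Fin n)) (t : ℕ)
    (ht : Nat.card {i : Fin n | x i = i} = t) (htn : t < n - 3) :
    ∃ y : Equiv.Perm (Fin n), y ∈ alternatingGroup (Fin n) ∧
      t + 1 ≤ Nat.card {i : Fin n | (x * (y⁻¹ * x * y)) i = i} ∧
      Nat.card {i : Fin n | (x * (y⁻¹ * x * y)) i = i} < n := by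
  have hfix := card_fixed_eq_sub_support x
  have hle : x.support.card ≤ n := by simpa using x.support.card_le_univ
  have hx : 4 ≤ x.support.card := by omega
  obtain ⟨w, hw⟩ := exists_conj_eq_inv x
  obtain ⟨c, hc, hcx, s, hs, hcard⟩ := exists_noncomm_swap hn hx
  rcases Int.units_eq_one_or (sign w) with hsw | hsw
  · by_cases h : Subgroup.centralizer {x} ≤ alternatingGroup (Fin n)
    · obtain ⟨k, hk, hk5⟩ := exists_five_le_mem_cycleType hx h
      obtain ⟨d, hd, hdx, s', hs', hcard'⟩ := exists_noncomm_threeCycle hk hk5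
      exact exists_even_conj_of_inverter hw (by simp [hsw, hd]) hdx s' hs' (by omega)
    · obtain ⟨g, hgx, hg⟩ := SetLike.not_le_iff_exists.mp h
      rw [Subgroup.mem_centralizer_singleton_iff] at hgx
      rw [mem_alternatingGroup] at hg
      have hsg := (Int.units_eq_one_or (sign g)).resolve_left hg
      have hgw : (g * w)⁻¹ * x * (g * w) = x⁻¹ := by
        calc (g * w)⁻¹ * x * (g * w) = w⁻¹ * g⁻¹ * (x * g) * w := by group
          _ = w⁻¹ * g⁻¹ * (g * x) * w := by rw [hgx]
          _ = w⁻¹ * x * w := by group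
          _ = x⁻¹ := hw
      exact exists_even_conj_of_inverter hgw (by simp [hsw, hsg, hc]) hcx s hs (by omega)
  · exact exists_even_conj_of_inverter hw (by simp [hsw, hc]) hcx s hs (by omega)
end

section
/- Let G be a finite group that does not have a normal 2-complement; that is, there is no normal subgroup N of G of odd order such that the quotient G/N is a 2-group. Then there exist x, y ∈ G whose commutator [x,y] = x⁻¹y⁻¹xy has even order. -/
open Subgroup in
/-- If every commutator has order prime to `p`, then every Sylow `p`-subgroup `P` satisfies
`N(P) ≤ C(P)`. -/
theorem Sylow.normalizer_le_centralizer_of_not_dvd_orderOf {G : Type*} [Group G] {p : ℕ}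
    [Fact p.Prime] (P : Sylow p G) (h : ∀ x y : G, ¬ p ∣ orderOf (x⁻¹ * y⁻¹ * x * y)) :
    normalizer (P : Set G) ≤ centralizer (P : Set G) := by
  intro g hg
  rw [mem_centralizer_iff]
  intro x hx
  have hxg : g⁻¹ * x * g ∈ P := (mem_normalizer_iff''.mp hg x).mp hx
  have hmem : x⁻¹ * g⁻¹ * x * g ∈ (P : Subgroup G) := by
    simpa only [mul_assoc] using (P : Subgroup G).mul_mem (inv_mem hx) hxg
  obtain ⟨k, hk⟩ := IsPGroup.iff_orderOf.mp P.isPGroup' ⟨_, hmem⟩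
  rw [Subgroup.orderOf_mk] at hk
  have hk0 : k = 0 := by
    by_contra hk0
    exact h x g (hk ▸ dvd_pow_self p hk0)
  rw [hk0, pow_zero, orderOf_eq_one_iff] at hk
  calc x * g = g * x * (x⁻¹ * g⁻¹ * x * g) := by group
    _ = g * x := by rw [hk, mul_one]

/-- **Lemma 4.3.**  If a finite group `G` has no normal `2`-complement, then some
commutator `[x,y]` has even order. -/
theorem stmt17 {G : Type*} [Group G] [Fintype G]
    (h : ¬ ∃ N : Subgroup G, N.Normal ∧ Odd (Nat.card N) ∧ ∃ k : ℕ, N.index = 2 ^ k) :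
    ∃ x y : G, Even (orderOf (x⁻¹ * y⁻¹ * x * y)) := by
  by_contra! hodd
  let P : Sylow 2 G := default
  have hP := P.normalizer_le_centralizer_of_not_dvd_orderOf
    fun x y => mt even_iff_two_dvd.mpr (by simpa using hodd x y)
  refine h ⟨(MonoidHom.transferSylow P hP).ker, inferInstance, ?_, ?_⟩
  · rw [← Nat.not_even_iff_odd, even_iff_two_dvd]
    exact MonoidHom.not_dvd_card_ker_transferSylow P hP
  · rw [(MonoidHom.ker_transferSylow_isComplement' P hP).symm.index_eq_card]
    exact IsPGroup.iff_card.mp P.isPGroup'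
end

section
/- Let F be a finite field, n ≥ 2, and let V = Fⁿ be the natural module for SL_n(F). If v, w ∈ V are nonzero vectors with span{v} ≠ span{w}, then there exists x ∈ SL_n(F) with x ∉ Z(SL_n(F)) and x² ∈ Z(SL_n(F)) (a projective involution) such that x maps the line span{v} onto the line span{w}. Moreover, if |F| is even or n > 2, then x can be chosen so that x·v = w. -/
open Matrix in
/-- Given linearly independent vectors `v` and `w`, some matrix of determinant one whose square is
`1` or `-1` maps `v` to `w`. -/
theorem exists_det_one_sq_eq_one_or_neg_one_mulVec_eq {F : Type*} [Field F] {n : ℕ}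
    {v w : Fin n → F} (h : LinearIndependent F ![v, w]) :
    ∃ x : Matrix (Fin n) (Fin n) F, x.det = 1 ∧ (x * x = 1 ∨ x * x = -1) ∧ x *ᵥ v = w := by
  let b₀ := Module.Basis.sumExtend h
  let σ := b₀.indexEquiv (Pi.basisFun F (Fin n))
  let b := b₀.reindex σ
  set i := σ (Sum.inl 0) with hi
  set j := σ (Sum.inl 1) with hj
  have hij : i ≠ j := by simp [hi, hj]
  have hbi : b i = v := by
    simp [b, hi, b₀, Module.Basis.sumExtend]
    rfl
  have hbj : b j = w := by
    simp [b, hj, b₀, Module.Basis.sumExtend]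
    rfl
  obtain ⟨k, hki, hk⟩ : ∃ k, k ≠ i ∧ (k ≠ j ∨ ∀ l, l = i ∨ l = j) := by
    by_cases hall : ∀ l, l = i ∨ l = j
    · exact ⟨j, hij.symm, Or.inr hall⟩
    · push Not at hall
      obtain ⟨l, hl, hl'⟩ := hall
      exact ⟨l, hl, Or.inl hl'⟩
  let d : Fin n → F := Function.update 1 k (-1)
  let M : Matrix (Fin n) (Fin n) F := (Equiv.swap i j).permMatrix F * diagonal d
  have hdet : M.det = 1 := by
    simp [M, d, det_permutation, Equiv.Perm.sign_swap hij, Finset.prod_update_of_mem]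
  have hMapply (p q : Fin n) : M p q = if Equiv.swap i j p = q then d q else 0 := by
    simp [M, PEquiv.toMatrix_apply, eq_comm]
  have hMM : M * M = diagonal fun p => d (Equiv.swap i j p) * d p := by
    ext p q
    rw [mul_apply, Finset.sum_eq_single (Equiv.swap i j p)]
    · by_cases hpq : p = q <;> simp [hMapply, hpq]
    · intro l _ hl
      simp [hMapply, hl.symm]
    · simp
  have hsq : M * M = 1 ∨ M * M = -1 := by
    rw [hMM]
    rcases hk with hk | hk
    · left
      rw [← diagonal_one]
      congr 1
      ext p
      simp only [d, Function.update_apply, Equiv.swap_apply_def, Pi.one_apply]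
      grind
    · right
      rw [← diagonal_one, diagonal_neg]
      congr 1
      ext p
      have := hk p
      have := hk k
      simp only [d, Function.update_apply, Equiv.swap_apply_def, Pi.one_apply]
      grind
  refine ⟨LinearMap.toMatrix' (toLin b b M), ?_, ?_, ?_⟩
  · rw [LinearMap.det_toMatrix', LinearMap.det_toLin, hdet]
  · rw [← LinearMap.toMatrix'_mul, Module.End.mul_eq_comp, ← toLin_mul]
    rcases hsq with hsq | hsq
    · left; simp [hsq]
    · right; simp [hsq]
  · rw [LinearMap.toMatrix'_mulVec, ← hbi, toLin_self, ← hbj,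
      Finset.sum_eq_single j]
    · simp [hMapply, d, hki.symm]
    · intro l _ hl
      have : Equiv.swap i j l ≠ i := by
        rw [Ne, Equiv.swap_apply_eq_iff, Equiv.swap_apply_left]; exact hl
      simp [hMapply, this]
    · simp

/-- **Proposition 4.9(i).**  Let `V = Fⁿ` be the natural module for `SL_n(F)`, `n ≥ 2`,
and let `v, w ∈ V` be nonzero with `⟨v⟩ ≠ ⟨w⟩`.  Then some projective involution
`x ∈ SL_n(F)` maps `⟨v⟩` onto `⟨w⟩`; moreover if `|F|` is even or `n > 2`, `x` may be
chosen with `x v = w`. -/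
theorem stmt18 (F : Type*) [Field F] [Fintype F] (n : ℕ) (hn : 2 ≤ n)
    (v w : Fin n → F) (hv : v ≠ 0) (hw : w ≠ 0)
    (hvw : Submodule.span F {v} ≠ Submodule.span F {w}) :
    (∃ x : Matrix.SpecialLinearGroup (Fin n) F,
        x ∉ Subgroup.center (Matrix.SpecialLinearGroup (Fin n) F) ∧
        x ^ 2 ∈ Subgroup.center (Matrix.SpecialLinearGroup (Fin n) F) ∧
        Submodule.span F {(x : Matrix (Fin n) (Fin n) F).mulVec v} = Submodule.span F {w}) ∧
      ((Even (Fintype.card F) ∨ 2 < n) →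
        ∃ x : Matrix.SpecialLinearGroup (Fin n) F,
          x ∉ Subgroup.center (Matrix.SpecialLinearGroup (Fin n) F) ∧
          x ^ 2 ∈ Subgroup.center (Matrix.SpecialLinearGroup (Fin n) F) ∧
          (x : Matrix (Fin n) (Fin n) F).mulVec v = w) := by
  have hli : LinearIndependent F ![v, w] := by
    rw [LinearIndependent.pair_iff' hv]
    rintro a rfl
    have ha : a ≠ 0 := by
      rintro rfl
      simp at hw
    exact hvw (Submodule.span_singleton_smul_eq ha.isUnit v).symm
  obtain ⟨A, hdet, hsq, hA⟩ := exists_det_one_sq_eq_one_or_neg_one_mulVec_eq hli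
  let x : Matrix.SpecialLinearGroup (Fin n) F := ⟨A, hdet⟩
  have hx : x ∉ Subgroup.center (Matrix.SpecialLinearGroup (Fin n) F) := by
    rw [Matrix.SpecialLinearGroup.mem_center_iff]
    rintro ⟨r, -, hr⟩
    rw [LinearIndependent.pair_iff' hv] at hli
    refine hli r ?_
    rw [← hA, show A = Matrix.scalar (Fin n) r from hr.symm]
    ext p
    simp [Matrix.mulVec_diagonal]
  have hx2 : x ^ 2 ∈ Subgroup.center (Matrix.SpecialLinearGroup (Fin n) F) := by
    rw [Subgroup.mem_center_iff]
    intro g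
    apply Subtype.ext
    change (g : Matrix (Fin n) (Fin n) F) * ((x ^ 2 : Matrix.SpecialLinearGroup (Fin n) F) :
      Matrix (Fin n) (Fin n) F) = ((x ^ 2 : Matrix.SpecialLinearGroup (Fin n) F) :
      Matrix (Fin n) (Fin n) F) * g
    rw [Matrix.SpecialLinearGroup.coe_pow, sq]
    change _ * (A * A) = (A * A) * _
    rcases hsq with hsq | hsq <;> simp [hsq]
  exact ⟨⟨x, hx, hx2, congrArg (fun u => Submodule.span F {u}) hA⟩, fun _ => ⟨x, hx, hx2, hA⟩⟩
end

section
/- Let G be a finite group and K a normal subset of G all of whose elements have odd order, and suppose K² ⊆ D_K. Let t ∈ G be an involution and a ∈ K. Then a·a^t and a^t·a lie in D_K, and the order of ta is either odd or equal to twice an odd number. -/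
/-- If the square of `g` has odd order, then the order of `g` is odd or twice an odd number. -/
theorem odd_orderOf_or_eq_two_mul_of_odd_orderOf_sq {G : Type*} [Group G] {g : G}
    (h : Odd (orderOf (g ^ 2))) :
    Odd (orderOf g) ∨ ∃ m : ℕ, Odd m ∧ orderOf g = 2 * m := by
  rcases Nat.even_or_odd' (orderOf g) with ⟨m, hm | hm⟩
  · refine Or.inr ⟨m, h.of_dvd_nat ?_, hm⟩
    have hdvd : orderOf g ∣ 2 * orderOf (g ^ 2) :=
      orderOf_dvd_of_pow_eq_one (by rw [pow_mul, pow_orderOf_eq_one])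
    rw [hm] at hdvd
    exact Nat.dvd_of_mul_dvd_mul_left two_pos hdvd
  · exact Or.inl ⟨m, hm⟩

/-- **Lemma 5.10.**  Let `K` be a normal subset of odd-order elements of a finite group
`G` with `K² ⊆ D_K`, let `t` be an involution and `a ∈ K`.  Then `a a^t, a^t a ∈ D_K`,
and `ta` has order either odd or twice an odd number. -/
theorem stmt19 {G : Type*} [Group G] [Fintype G] (K : Set G)
    (hnormal : ∀ g : G, ∀ k ∈ K, g⁻¹ * k * g ∈ K)
    (hodd : ∀ k ∈ K, Odd (orderOf k))
    (hsq : ∀ m ∈ K, ∀ n ∈ K,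
      m * n ∈ {x : G | ∃ y ∈ K, Subgroup.zpowers x = Subgroup.zpowers y})
    (t : G) (ht : orderOf t = 2) (a : G) (ha : a ∈ K) :
    a * (t⁻¹ * a * t) ∈ {x : G | ∃ y ∈ K, Subgroup.zpowers x = Subgroup.zpowers y} ∧
      (t⁻¹ * a * t) * a ∈ {x : G | ∃ y ∈ K, Subgroup.zpowers x = Subgroup.zpowers y} ∧
      (Odd (orderOf (t * a)) ∨ ∃ m : ℕ, Odd m ∧ orderOf (t * a) = 2 * m) := by
  have hconj : t⁻¹ * a * t ∈ K := hnormal t a ha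
  have hmem := hsq _ hconj a ha
  refine ⟨hsq a ha _ hconj, hmem, odd_orderOf_or_eq_two_mul_of_odd_orderOf_sq ?_⟩
  have ht_inv : t⁻¹ = t := inv_eq_of_mul_eq_one_left (by rw [← sq, ← ht, pow_orderOf_eq_one])
  have hsquare : (t * a) ^ 2 = t⁻¹ * a * t * a := by rw [ht_inv, sq, ← mul_assoc]
  obtain ⟨y, hy, hxy⟩ := hmem
  rw [hsquare, ← Nat.card_zpowers, hxy, Nat.card_zpowers]
  exact hodd y hy
end
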